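/- Modulus of continuity bound uniform in endpoint: for any ν, ε, T, M > 0 there exist N₀ ∈ ℕ and δ > 0 such that for all N ≥ N₀, sup over |z| ≤ M·N^{1/3} of P^{0,z}_{[0,T·N^{2/3}]}( w(y^N, δ) ≥ ε ) < ν, where y^N(t) = N^{-1/3}·Y(t·N^{2/3}) is the diffusively rescaled random walk bridge Y from 0 to z on ⟦0, T·N^{2/3}⟧ and w(f,δ) is the modulus of continuity sup_{|s-t|<δ}|f(s)-f(t)|. -/

import Mathlib

open MeasureTheory Real
open scoped ENNReal

noncomputable section

/-- The full trajectory over `⟦0, n+1⟧` of a bridge with boundary values `u, v`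
and interior values `q`. -/
def pathOf (u v : ℝ) (n : ℕ) (q : Fin n → ℝ) : ℕ → ℝ :=
  fun t => if h : 1 ≤ t ∧ t ≤ n then q ⟨t - 1, by omega⟩ else if t = 0 then u else v

/-- Unnormalized density of a random walk bridge on `⟦0, n+1⟧` from `u` to `v`,
with increment Hamiltonian `H`: the product of `exp(-H(increment))` over all steps. -/
def bridgeDensity (H : ℝ → ℝ) (u v : ℝ) (n : ℕ) (q : Fin n → ℝ) : ℝ :=
  ∏ j ∈ Finset.range (n + 1),
    Real.exp (-(H (pathOf u v n q (j + 1) - pathOf u v n q j)))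

/-- The (unnormalized) law of the interior points of a random walk bridge. -/
def bridgeMeasure (H : ℝ → ℝ) (u v : ℝ) (n : ℕ) : Measure (Fin n → ℝ) :=
  volume.withDensity fun q => ENNReal.ofReal (bridgeDensity H u v n q)

open scoped Classical in
/-- The (unnormalized) law of a random walk bridge on `⟦0, n+1⟧` from `u` to `v`
constrained to stay above the floor in the interior, with area tilt
`exp(-c · Σ_j (X(j) - floor(j)))`. -/
def tiltedMeasure (H : ℝ → ℝ) (u v : ℝ) (n : ℕ) (c : ℝ) (floor : ℕ → ℝ) :
    Measure (Fin n → ℝ) :=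
  volume.withDensity fun q =>
    ENNReal.ofReal (bridgeDensity H u v n q
      * Real.exp (-(c * ∑ j ∈ Finset.range (n + 1), (pathOf u v n q j - floor j)))
      * if ∀ t, 1 ≤ t → t ≤ n → floor t ≤ pathOf u v n q t then 1 else 0)

/-- Probability of an event under the normalization of a finite measure. -/
def probOf {α : Type*} [MeasurableSpace α] (μ : Measure α) (E : Set α) : ℝ≥0∞ :=
  μ E / μ Set.univ

/-- The normalized (probability) version of a measure. -/
def normalizeMeasure {α : Type*} [MeasurableSpace α] (μ : Measure α) : Measure α :=
  (μ Set.univ)⁻¹ • μ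

/-- Fluctuation scale `H_λ = λ^{-1/3} N^{1/3}`. -/
def Hlam (lam N : ℝ) : ℝ := lam ^ (-(1 : ℝ) / 3) * N ^ ((1 : ℝ) / 3)

/-- Assumptions on the random walk Hamiltonian: convexity (log-concavity of the
increment density), zero mean, positive finite variance, and finite exponential
moments near zero. -/
structure RWAssumptions (H : ℝ → ℝ) : Prop where
  convex : ConvexOn ℝ Set.univ H
  integrable_exp : Integrable fun x : ℝ => Real.exp (-(H x))
  norm_pos : 0 < ∫ x : ℝ, Real.exp (-(H x))
  mean_zero : (∫ x : ℝ, x * Real.exp (-(H x))) = 0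
  integrable_sq : Integrable fun x : ℝ => x ^ 2 * Real.exp (-(H x))
  var_pos : 0 < ∫ x : ℝ, x ^ 2 * Real.exp (-(H x))
  mgf : ∃ t₀ > 0, ∀ t : ℝ, |t| ≤ t₀ →
    Integrable fun x : ℝ => Real.exp (t * x) * Real.exp (-(H x))

end

noncomputable section

/-- Linear interpolation of a discrete trajectory `p : ℕ → ℝ` at a real
(nonnegative) time `s`. -/
def interpPath (p : ℕ → ℝ) (s : ℝ) : ℝ :=
  (1 - (s - (⌊s⌋₊ : ℝ))) * p ⌊s⌋₊ + (s - (⌊s⌋₊ : ℝ)) * p (⌊s⌋₊ + 1)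

/-- Modulus of continuity of `f` on `[0,T]` at scale `δ`. -/
def wMod (f : ℝ → ℝ) (T δ : ℝ) : ℝ :=
  sSup {d | ∃ s t : ℝ, s ∈ Set.Icc 0 T ∧ t ∈ Set.Icc 0 T ∧ |s - t| < δ ∧
    d = |f s - f t|}

end

open Set Filter Topology ProbabilityTheory

/-- The exchange form of log-concavity: moving two arguments towards each other, keeping their
sum fixed, does not decrease the product of the values. -/
def ExchangeLogConcave (f : ℝ → ℝ≥0∞) : Prop :=
  ∀ a s t : ℝ, 0 ≤ s → 0 ≤ t → f a * f (a + s + t) ≤ f (a + s) * f (a + t)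

lemma lconvolution_eq_lintegral_sub (f g : ℝ → ℝ≥0∞) (x : ℝ) :
    (f ⋆ₗ g) x = ∫⁻ u, f (x - u) * g u := by
  rw [lconvolution_comm, lconvolution_def]
  exact lintegral_congr fun u => by rw [mul_comm, neg_add_eq_sub]

lemma lconvolution_add_eq_lintegral_sub (f g : ℝ → ℝ≥0∞) (x t : ℝ) :
    (f ⋆ₗ g) (x + t) = ∫⁻ u, f (x - u) * g (u + t) := by
  rw [lconvolution_eq_lintegral_sub,
    ← lintegral_add_right_eq_self (fun u => f (x + t - u) * g u) t]
  exact lintegral_congr fun u => by rw [add_sub_add_right_eq_sub]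

lemma ENNReal.mul_add_mul_le_mul_add_mul {a b c d : ℝ≥0∞} (hab : a ≤ b) (hcd : c ≤ d) :
    a * d + b * c ≤ a * c + b * d := by
  obtain ⟨e, rfl⟩ := exists_add_of_le hcd
  calc a * (c + e) + b * c = (a * c + b * c) + a * e := by ring
    _ ≤ (a * c + b * c) + b * e := by gcongr
    _ = a * c + b * (c + e) := by ring

lemma lintegral_mul_swap_le {A B : ℝ → ℝ → ℝ≥0∞}
    (hA : Measurable (Function.uncurry A)) (hB : Measurable (Function.uncurry B))
    (hA' : ∀ u v, u ≤ v → A v u ≤ A u v) (hB' : ∀ u v, u ≤ v → B v u ≤ B u v) :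
    ∫⁻ u, ∫⁻ v, A u v * B v u ≤ ∫⁻ u, ∫⁻ v, A u v * B u v := by
  have hAs : Measurable (Function.uncurry fun u v => A v u) := hA.comp measurable_swap
  have hBs : Measurable (Function.uncurry fun u v => B v u) := hB.comp measurable_swap
  have m1 : Measurable (Function.uncurry fun u v => A u v * B v u) := hA.mul hBs
  have m2 : Measurable (Function.uncurry fun u v => A u v * B u v) := hA.mul hB
  have s1 : ∫⁻ u, ∫⁻ v, A u v * B v u = ∫⁻ u, ∫⁻ v, A v u * B u v :=
    lintegral_lintegral_swap m1.aemeasurable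
  have s2 : ∫⁻ u, ∫⁻ v, A u v * B u v = ∫⁻ u, ∫⁻ v, A v u * B v u :=
    lintegral_lintegral_swap m2.aemeasurable
  have key : ∫⁻ u, ∫⁻ v, (A u v * B v u + A v u * B u v)
      ≤ ∫⁻ u, ∫⁻ v, (A u v * B u v + A v u * B v u) := by
    refine lintegral_mono fun u => lintegral_mono fun v => ?_
    rcases le_total u v with h | h
    · have := ENNReal.mul_add_mul_le_mul_add_mul (hA' u v h) (hB' u v h)
      calc _ = A v u * B u v + A u v * B v u := add_comm _ _
        _ ≤ _ := this
        _ = _ := add_comm _ _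
    · exact ENNReal.mul_add_mul_le_mul_add_mul (hA' v u h) (hB' v u h)
  have m3 : Measurable (Function.uncurry fun u v => A v u * B u v) := hAs.mul hB
  have m4 : Measurable (Function.uncurry fun u v => A v u * B v u) := hAs.mul hBs
  have e : ∀ F G : ℝ → ℝ → ℝ≥0∞, Measurable (Function.uncurry F) →
      Measurable (Function.uncurry G) →
      ∫⁻ u, ∫⁻ v, (F u v + G u v) = (∫⁻ u, ∫⁻ v, F u v) + ∫⁻ u, ∫⁻ v, G u v := by
    intro F G hF hG
    rw [← lintegral_add_left (f := fun u => ∫⁻ v, F u v) hF.lintegral_prod_right']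
    exact lintegral_congr fun u => lintegral_add_left hF.of_uncurry_left _
  rw [e _ _ m1 m3, e _ _ m2 m4, ← s1, ← s2, ← two_mul, ← two_mul] at key
  exact (ENNReal.mul_le_mul_iff_right two_ne_zero ENNReal.ofNat_ne_top).1 key

lemma ExchangeLogConcave.lconvolution {f g : ℝ → ℝ≥0∞} (hf : ExchangeLogConcave f)
    (hg : ExchangeLogConcave g) (mf : Measurable f) (mg : Measurable g) :
    ExchangeLogConcave (f ⋆ₗ g) := by
  intro a s t hs ht
  rw [lconvolution_add_eq_lintegral_sub f g (a + s) t, lconvolution_add_eq_lintegral_sub f g a t,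
    lconvolution_eq_lintegral_sub f g a, lconvolution_eq_lintegral_sub f g (a + s)]
  have hp : ∀ F G : ℝ → ℝ≥0∞, Measurable F → Measurable G →
      (∫⁻ u, F u) * ∫⁻ v, G v = ∫⁻ u, ∫⁻ v, F u * G v := by
    intro F G hF hG
    rw [← lintegral_mul_const _ hF]
    exact lintegral_congr fun u => (lintegral_const_mul _ hG).symm
  rw [hp _ _ (by fun_prop) (by fun_prop), mul_comm, hp _ _ (by fun_prop) (by fun_prop)]
  have := lintegral_mul_swap_le (A := fun u v => f (a - u) * f (a + s - v))
    (B := fun u v => g (u + t) * g v) (by fun_prop) (by fun_prop)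
    (fun u v huv => by
      have := hf (a - v) s (v - u) hs (sub_nonneg.2 huv)
      rw [show a - v + s + (v - u) = a + s - u by ring, show a - v + s = a + s - v by ring,
        show a - v + (v - u) = a - u by ring] at this
      rwa [mul_comm (f (a - u))])
    (fun u v huv => by
      have := hg u (v - u) t (sub_nonneg.2 huv) ht
      rw [show u + (v - u) = v by ring] at this
      rw [mul_comm, mul_comm (g (u + t))]
      exact this)
  refine le_trans (le_of_eq ?_) (this.trans (le_of_eq ?_))
  · exact lintegral_congr fun u => lintegral_congr fun v => by ring
  · exact lintegral_congr fun u => lintegral_congr fun v => by ring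

lemma pathOf_zero (u v : ℝ) (n : ℕ) (q : Fin n → ℝ) : pathOf u v n q 0 = u := by
  simp [pathOf]

lemma pathOf_of_lt (u v : ℝ) {n t : ℕ} (q : Fin n → ℝ) (h : n < t) : pathOf u v n q t = v := by
  have h1 : ¬ (1 ≤ t ∧ t ≤ n) := by omega
  have h2 : t ≠ 0 := by omega
  simp [pathOf, h1, h2]

lemma pathOf_min (u v : ℝ) (n t : ℕ) (q : Fin n → ℝ) :
    pathOf u v n q (min t (n + 1)) = pathOf u v n q t := by
  rcases le_total t (n + 1) with h | h
  · rw [min_eq_left h]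
  · rw [min_eq_right h, pathOf_of_lt _ _ _ (Nat.lt_succ_self n),
      pathOf_of_lt _ _ _ (Nat.lt_of_succ_le h)]

lemma pathOf_cons_succ (u v x : ℝ) (n t : ℕ) (q : Fin n → ℝ) :
    pathOf u v (n + 1) (Fin.cons x q : Fin (n + 1) → ℝ) (t + 1) = pathOf x v n q t := by
  rcases t with _ | t
  · rw [pathOf_zero]
    simp only [pathOf]
    rw [dif_pos (by omega)]
    rfl
  · rcases Nat.lt_or_ge n (t + 1) with h | h
    · rw [pathOf_of_lt _ _ _ h, pathOf_of_lt _ _ _ (by omega)]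
    · simp only [pathOf]
      rw [dif_pos (by omega), dif_pos (by omega)]
      rfl

lemma measurable_pathOf (u v : ℝ) (n t : ℕ) : Measurable fun q => pathOf u v n q t := by
  unfold pathOf
  split_ifs <;> fun_prop

/-- The density at `y` of the sum of `n + 1` independent increments with densities
`w 0, …, w n`. -/
noncomputable def incrConv (w : ℕ → ℝ → ℝ≥0∞) : ℕ → ℝ → ℝ≥0∞
  | 0 => w 0
  | n + 1 => w 0 ⋆ₗ incrConv (fun i => w (i + 1)) n

lemma lintegral_prod_increments (n : ℕ) (w : ℕ → ℝ → ℝ≥0∞) (hw : ∀ i, Measurable (w i))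
    (u v : ℝ) :
    ∫⁻ q : Fin n → ℝ, ∏ j ∈ Finset.range (n + 1),
      w j (pathOf u v n q (j + 1) - pathOf u v n q j) = incrConv w n (v - u) := by
  induction n generalizing w u with
  | zero =>
    simp [incrConv, pathOf, lintegral_unique, volume_pi]
  | succ n ih =>
    have e := (volume_preserving_piFinSuccAbove (fun _ : Fin (n + 1) => ℝ) 0).symm
    have hm : ∀ k : ℕ, Measurable fun q : Fin (n + 1) → ℝ => ∏ j ∈ Finset.range k,
        w j (pathOf u v (n + 1) q (j + 1) - pathOf u v (n + 1) q j) := fun k =>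
      Finset.measurable_fun_prod _ fun j _ => (hw j).comp
        ((measurable_pathOf u v (n + 1) (j + 1)).sub (measurable_pathOf u v (n + 1) j))
    rw [← e.lintegral_comp (hm _), Measure.volume_eq_prod]
    refine (lintegral_prod _ ((hm (n + 1 + 1)).comp e.measurable).aemeasurable).trans ?_
    have : ∀ x : ℝ, ∫⁻ q : Fin n → ℝ, ∏ j ∈ Finset.range (n + 1 + 1),
        w j (pathOf u v (n + 1) (Fin.cons x q : Fin (n + 1) → ℝ) (j + 1)
          - pathOf u v (n + 1) (Fin.cons x q : Fin (n + 1) → ℝ) j)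
        = w 0 (x - u) * incrConv (fun i => w (i + 1)) n (v - x) := by
      intro x
      rw [← ih (fun i => w (i + 1)) (fun i => hw _) x, ← lintegral_const_mul]
      · refine lintegral_congr fun q => ?_
        rw [Finset.prod_range_succ', mul_comm]
        simp only [pathOf_cons_succ, pathOf_zero]
      · exact Finset.measurable_fun_prod _ fun j _ => (hw _).comp
          ((measurable_pathOf x v n (j + 1)).sub (measurable_pathOf x v n j))
    have hcons : ∀ (x : ℝ) (q : Fin n → ℝ),
        (MeasurableEquiv.piFinSuccAbove (fun _ : Fin (n + 1) => ℝ) 0).symm (x, q)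
          = (Fin.cons x q : Fin (n + 1) → ℝ) := fun x q => Fin.insertNth_zero' x q
    simp only [Function.comp_def, hcons, this]
    rw [incrConv, lconvolution_def,
      ← lintegral_sub_right_eq_self
        (fun y => w 0 y * incrConv (fun i => w (i + 1)) n (-y + (v - u))) u]
    exact lintegral_congr fun x => by rw [show -(x - u) + (v - u) = v - x by ring]

/-- The `(k + 1)`-fold convolution power of `f`. -/
noncomputable def convPow (f : ℝ → ℝ≥0∞) (k : ℕ) : ℝ → ℝ≥0∞ := (fun h => f ⋆ₗ h)^[k] f

lemma convPow_succ (f : ℝ → ℝ≥0∞) (k : ℕ) : convPow f (k + 1) = f ⋆ₗ convPow f k :=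
  Function.iterate_succ_apply' _ _ _

lemma measurable_convPow {f : ℝ → ℝ≥0∞} (hf : Measurable f) (k : ℕ) :
    Measurable (convPow f k) := by
  induction k with
  | zero => exact hf
  | succ k ih => rw [convPow_succ]; fun_prop

lemma incrConv_const (f : ℝ → ℝ≥0∞) (n : ℕ) : incrConv (fun _ => f) n = convPow f n := by
  induction n with
  | zero => rfl
  | succ n ih => rw [convPow_succ, ← ih]; rfl

lemma ExchangeLogConcave.convPow {f : ℝ → ℝ≥0∞} (hf : ExchangeLogConcave f) (mf : Measurable f)
    (k : ℕ) : ExchangeLogConcave (convPow f k) := by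
  induction k with
  | zero => exact hf
  | succ k ih => rw [convPow_succ]; exact hf.lconvolution ih mf (measurable_convPow mf k)

/-- The convolution of `a` copies of `f` with `b` copies of `g` (just `f` if `a = b = 0`). -/
noncomputable def mixedConv (f g : ℝ → ℝ≥0∞) (a b : ℕ) : ℝ → ℝ≥0∞ :=
  match a, b with
  | a + 1, b => (fun h => g ⋆ₗ h)^[b] (convPow f a)
  | 0, b + 1 => convPow g b
  | 0, 0 => f

lemma measurable_iterate_lconvolution {g h : ℝ → ℝ≥0∞} (hg : Measurable g) (hh : Measurable h)
    (b : ℕ) : Measurable ((fun h => g ⋆ₗ h)^[b] h) := by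
  induction b with
  | zero => exact hh
  | succ b ih => rw [Function.iterate_succ_apply']; fun_prop

lemma lconvolution_iterate_comm {f g h : ℝ → ℝ≥0∞} (hf : Measurable f) (hg : Measurable g)
    (hh : Measurable h) (b : ℕ) :
    f ⋆ₗ ((fun h => g ⋆ₗ h)^[b] h) = (fun h => g ⋆ₗ h)^[b] (f ⋆ₗ h) := by
  induction b with
  | zero => rfl
  | succ b ih =>
    have := measurable_iterate_lconvolution hg hh b
    rw [Function.iterate_succ_apply', Function.iterate_succ_apply', ← ih,
      lconvolution_assoc hf hg this, lconvolution_comm (f := f) (g := g),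
      ← lconvolution_assoc hg hf this]

lemma lconvolution_mixedConv_left {f g : ℝ → ℝ≥0∞} (hf : Measurable f) (hg : Measurable g)
    {a b : ℕ} (hab : 0 < a + b) : f ⋆ₗ mixedConv f g a b = mixedConv f g (a + 1) b := by
  rcases a with _ | a
  · obtain ⟨b, rfl⟩ : ∃ c, b = c + 1 := ⟨b - 1, by omega⟩
    change f ⋆ₗ ((fun h => g ⋆ₗ h)^[b] g) = (fun h => g ⋆ₗ h)^[b] (g ⋆ₗ f)
    rw [lconvolution_iterate_comm hf hg hg, lconvolution_comm]
  · change f ⋆ₗ ((fun h => g ⋆ₗ h)^[b] (convPow f a)) = (fun h => g ⋆ₗ h)^[b] (convPow f (a + 1))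
    rw [lconvolution_iterate_comm hf hg (measurable_convPow hf a), convPow_succ]

lemma lconvolution_mixedConv_right {f g : ℝ → ℝ≥0∞} {a b : ℕ} (hab : 0 < a + b) :
    g ⋆ₗ mixedConv f g a b = mixedConv f g a (b + 1) := by
  rcases a with _ | a
  · obtain ⟨b, rfl⟩ : ∃ c, b = c + 1 := ⟨b - 1, by omega⟩
    exact (convPow_succ g b).symm
  · exact (Function.iterate_succ_apply' (fun h => g ⋆ₗ h) b (convPow f a)).symm

lemma incrConv_ite {f g : ℝ → ℝ≥0∞} (hf : Measurable f) (hg : Measurable g)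
    (s : ℕ → Prop) [DecidablePred s] (n : ℕ) :
    incrConv (fun i => if s i then g else f) n
      = mixedConv f g (Nat.count (fun i => ¬ s i) (n + 1)) (Nat.count s (n + 1)) := by
  induction n generalizing s with
  | zero =>
    by_cases h : s 0
    · rw [show Nat.count s (0 + 1) = 1 by simp [Nat.count_succ, h],
        show Nat.count (fun i => ¬ s i) (0 + 1) = 0 by simp [Nat.count_succ, h]]
      simp [incrConv, mixedConv, h, convPow]
    · rw [show Nat.count s (0 + 1) = 0 by simp [Nat.count_succ, h],
        show Nat.count (fun i => ¬ s i) (0 + 1) = 1 by simp [Nat.count_succ, h]]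
      simp [incrConv, mixedConv, h, convPow]
  | succ n ih =>
    rw [incrConv, ih (fun i => s (i + 1)), Nat.count_succ' s, Nat.count_succ' (fun i => ¬ s i)]
    have hpos : 0 < Nat.count (fun i => ¬ s (i + 1)) (n + 1)
        + Nat.count (fun i => s (i + 1)) (n + 1) := by
      rw [Nat.count_succ, Nat.count_succ]
      by_cases h : s (n + 1) <;> simp [h]
    by_cases h : s 0
    · simpa [h] using lconvolution_mixedConv_right hpos
    · simpa [h] using lconvolution_mixedConv_left hf hg hpos

lemma lconvolution_le_mul {g h : ℝ → ℝ≥0∞} (hg : Measurable g) {B : ℝ≥0∞} (hB : ∀ x, h x ≤ B)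
    (x : ℝ) : (g ⋆ₗ h) x ≤ (∫⁻ y, g y) * B := by
  rw [lconvolution_def, ← lintegral_mul_const _ hg]
  exact lintegral_mono fun y => by gcongr; exact hB _

lemma mixedConv_succ_le {f g : ℝ → ℝ≥0∞} (hg : Measurable g) (a b : ℕ)
    {B : ℝ≥0∞} (hB : ∀ x, convPow f a x ≤ B) (x : ℝ) :
    mixedConv f g (a + 1) b x ≤ (∫⁻ y, g y) ^ b * B := by
  change ((fun h => g ⋆ₗ h)^[b] (convPow f a)) x ≤ _
  induction b generalizing x with
  | zero => simpa using hB x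
  | succ b ih =>
    rw [Function.iterate_succ_apply', pow_succ', mul_assoc]
    exact lconvolution_le_mul hg ih x

lemma map_sum_eq_withDensity_convPow {p : ℝ → ℝ≥0∞} (hp : Measurable p)
    {Ω : Type*} {mΩ : MeasurableSpace Ω} {P : Measure Ω} [IsProbabilityMeasure P]
    {X : ℕ → Ω → ℝ} (hX : ∀ i, Measurable (X i))
    (hlaw : ∀ i, P.map (X i) = volume.withDensity p) (hind : iIndepFun X P) (k : ℕ) :
    P.map (∑ i ∈ Finset.range (k + 1), X i) = volume.withDensity (convPow p k) := by
  induction k with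
  | zero => simpa [convPow] using hlaw 0
  | succ k ih =>
    rw [Finset.sum_range_succ, (hind.indepFun_sum_range_succ hX (k + 1)).map_add_eq_map_conv_map
      (by fun_prop) (hX _), ih, hlaw,
      conv_withDensity_eq_lconvolution (measurable_convPow hp k) hp, lconvolution_comm,
      convPow_succ]

lemma gaussianReal_Ioo_pos {v : NNReal} (hv : v ≠ 0) {a b : ℝ} (hab : a < b) :
    0 < gaussianReal 0 v (Ioo a b) := by
  refine pos_iff_ne_zero.2 fun h => ?_
  have := gaussianReal_absolutelyContinuous' 0 hv h
  rw [Real.volume_Ioo, ENNReal.ofReal_eq_zero] at this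
  linarith

/-- The mass given by convolution powers to a window at the diffusive scale is bounded below. -/
lemma exists_le_lintegral_convPow_Ioo {p : ℝ → ℝ≥0∞} (hp : Measurable p)
    [IsProbabilityMeasure (volume.withDensity p)]
    (hL : MemLp id 2 (volume.withDensity p)) (hmean : ∫ x, x ∂(volume.withDensity p) = 0)
    (hvar : Var[id; volume.withDensity p] ≠ 0) {a b : ℝ} (hab : a < b) :
    ∃ c : ℝ≥0∞, 0 < c ∧ ∀ᶠ k : ℕ in atTop,
      c ≤ ∫⁻ x in Ioo (a * √(k + 1)) (b * √(k + 1)), convPow p k x := by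
  obtain ⟨Ω, _, P, X, hX, hlaw, hind, _⟩ := exists_iid ℕ (volume.withDensity p)
  have hmap : ∀ i, P.map (X i) = volume.withDensity p := fun i => (hlaw i).map_eq
  have hV : Var[X 0; P] = Var[id; volume.withDensity p] := by
    rw [← hmap 0, variance_map (by fun_prop) (hX 0).aemeasurable]; rfl
  have hE : P[X 0] = 0 := by
    rw [← hmean, ← hmap 0, integral_map (hX 0).aemeasurable (by fun_prop)]
  have hM : MemLp (X 0) 2 P := by
    rw [← hmap 0] at hL
    exact (memLp_map_measure_iff (by fun_prop) (hX 0).aemeasurable).1 hL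
  have hv0 : Var[X 0; P].toNNReal ≠ 0 := by
    rw [hV]
    simpa using lt_of_le_of_ne (variance_nonneg _ _) hvar.symm
  have hY : HasLaw id (gaussianReal 0 Var[X 0; P].toNNReal)
      (gaussianReal 0 Var[X 0; P].toNNReal) := HasLaw.id
  have hclt := (tendstoInDistribution_inv_sqrt_mul_sum_sub hY hM hind fun i =>
    ⟨(hX i).aemeasurable, (hX 0).aemeasurable, by rw [hmap, hmap]⟩).tendsto
  have hlim := ProbabilityMeasure.le_liminf_measure_open_of_tendsto hclt
    (isOpen_Ioo (a := a) (b := b))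
  have hpos := gaussianReal_Ioo_pos hv0 hab
  obtain ⟨c, hc0, hc⟩ := exists_between hpos
  refine ⟨c, hc0, ?_⟩
  have hlt := hc.trans_le ((le_of_eq (by simp)).trans hlim)
  have hev := (tendsto_add_atTop_nat 1).eventually (eventually_lt_of_lt_liminf hlt)
  filter_upwards [hev] with k hk
  refine hk.le.trans ?_
  have hs : 0 < √((k : ℝ) + 1) := Real.sqrt_pos.2 (by positivity)
  rw [← withDensity_apply _ measurableSet_Ioo, ← map_sum_eq_withDensity_convPow hp hX hmap hind k]
  simp only [ProbabilityMeasure.coe_mk]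
  rw [Measure.map_apply (by fun_prop) measurableSet_Ioo,
    Measure.map_apply (by fun_prop) measurableSet_Ioo]
  refine measure_mono fun ω hω => ?_
  simp only [mem_preimage, mem_Ioo, hE, mul_zero, sub_zero, Nat.cast_add, Nat.cast_one,
    Finset.sum_apply] at hω ⊢
  rw [inv_mul_eq_div, lt_div_iff₀ hs, div_lt_iff₀ hs] at hω
  exact hω

lemma lintegral_convPow {p : ℝ → ℝ≥0∞} (hp : Measurable p) (h1 : ∫⁻ x, p x = 1) (k : ℕ) :
    ∫⁻ x, convPow p k x = 1 := by
  induction k with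
  | zero => exact h1
  | succ k ih =>
    have hm := measurable_convPow hp k
    simp only [convPow_succ, lconvolution_def]
    rw [lintegral_lintegral_swap (by fun_prop)]
    have : ∀ y, ∫⁻ x, p y * convPow p k (-y + x) = p y := fun y => by
      rw [lintegral_const_mul _ (by fun_prop), lintegral_add_left_eq_self, ih, mul_one]
    simp only [this, h1]

lemma mul_setLIntegral_mul_volume_le_one {h : ℝ → ℝ≥0∞} (hm : Measurable h)
    (h1 : ∫⁻ x, h x = 1) {x₀ : ℝ} {S A : Set ℝ} (hS : MeasurableSet S) (hA : MeasurableSet A)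
    (hSA : ∀ s ∈ S, ∀ y ∈ A, h x₀ * h y ≤ h (x₀ + s) * h (y - s)) :
    h x₀ * (∫⁻ y in A, h y) * volume S ≤ 1 := by
  have key : ∀ s ∈ S, h x₀ * (∫⁻ y in A, h y) ≤ h (x₀ + s) := fun s hs =>
    calc h x₀ * (∫⁻ y in A, h y) = ∫⁻ y in A, h x₀ * h y := (lintegral_const_mul _ hm).symm
      _ ≤ ∫⁻ y in A, h (x₀ + s) * h (y - s) := setLIntegral_mono' hA fun y hy => hSA s hs y hy
      _ ≤ ∫⁻ y, h (x₀ + s) * h (y - s) := setLIntegral_le_lintegral _ _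
      _ = h (x₀ + s) := by
        rw [lintegral_const_mul _ (by fun_prop), lintegral_sub_right_eq_self, h1, mul_one]
  calc h x₀ * (∫⁻ y in A, h y) * volume S = ∫⁻ _ in S, h x₀ * (∫⁻ y in A, h y) := by
        rw [setLIntegral_const]
    _ ≤ ∫⁻ s in S, h (x₀ + s) := setLIntegral_mono' hS key
    _ ≤ ∫⁻ s, h (x₀ + s) := setLIntegral_le_lintegral _ _
    _ = 1 := by rw [lintegral_add_left_eq_self, h1]

lemma ExchangeLogConcave.mul_right_tail_le {h : ℝ → ℝ≥0∞} (hh : ExchangeLogConcave h)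
    (hm : Measurable h) (h1 : ∫⁻ x, h x = 1) (x₀ L : ℝ) :
    h x₀ * (∫⁻ y in Ioi (x₀ + L), h y) * ENNReal.ofReal L ≤ 1 := by
  have := mul_setLIntegral_mul_volume_le_one hm h1 (x₀ := x₀) (S := Ioo 0 L)
    (A := Ioi (x₀ + L)) measurableSet_Ioo measurableSet_Ioi fun s hs y hy => by
      have hs' := hs.2
      have hy' : x₀ + L < y := hy
      have := hh x₀ s (y - s - x₀) hs.1.le (by linarith)
      rwa [show x₀ + s + (y - s - x₀) = y by ring, show x₀ + (y - s - x₀) = y - s by ring] at this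
  simpa [Real.volume_Ioo] using this

lemma ExchangeLogConcave.mul_left_tail_le {h : ℝ → ℝ≥0∞} (hh : ExchangeLogConcave h)
    (hm : Measurable h) (h1 : ∫⁻ x, h x = 1) (x₀ L : ℝ) :
    h x₀ * (∫⁻ y in Iio (x₀ - L), h y) * ENNReal.ofReal L ≤ 1 := by
  have := mul_setLIntegral_mul_volume_le_one hm h1 (x₀ := x₀) (S := Ioo (-L) 0)
    (A := Iio (x₀ - L)) measurableSet_Ioo measurableSet_Iio fun s hs y hy => by
      have hs' := hs.1
      have hy' : y < x₀ - L := hy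
      have := hh y (-s) (x₀ + s - y) (by linarith [hs.2]) (by linarith)
      rw [show y + -s + (x₀ + s - y) = x₀ by ring, show y + (x₀ + s - y) = x₀ + s by ring,
        ← sub_eq_add_neg] at this
      rwa [mul_comm, mul_comm (h (x₀ + s))]
  simpa [Real.volume_Ioo] using this

lemma ExchangeLogConcave.mass_mul_mass_le {h : ℝ → ℝ≥0∞} (hh : ExchangeLogConcave h)
    (hm : Measurable h) (h1 : ∫⁻ x, h x = 1) (z L : ℝ) :
    (∫⁻ x in Ioo (z - L) z, h x) * (∫⁻ y in Ioi z, h y) ≤ h z * ENNReal.ofReal L := by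
  have key : ∀ x ∈ Ioo (z - L) z, h x * (∫⁻ y in Ioi z, h y) ≤ h z := fun x hx =>
    calc h x * (∫⁻ y in Ioi z, h y) = ∫⁻ y in Ioi z, h x * h y := (lintegral_const_mul _ hm).symm
      _ ≤ ∫⁻ y in Ioi z, h z * h (y - (z - x)) := by
        refine setLIntegral_mono' measurableSet_Ioi fun y hy => ?_
        have hy' : z < y := hy
        have := hh x (z - x) (y - z) (by linarith [hx.2]) (by linarith)
        rwa [show x + (z - x) + (y - z) = y by ring, show x + (z - x) = z by ring,
          show x + (y - z) = y - (z - x) by ring] at this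
      _ ≤ ∫⁻ y, h z * h (y - (z - x)) := setLIntegral_le_lintegral _ _
      _ = h z := by
        rw [lintegral_const_mul _ (by fun_prop), lintegral_sub_right_eq_self, h1, mul_one]
  calc (∫⁻ x in Ioo (z - L) z, h x) * (∫⁻ y in Ioi z, h y)
      = ∫⁻ x in Ioo (z - L) z, h x * (∫⁻ y in Ioi z, h y) := (lintegral_mul_const _ hm).symm
    _ ≤ ∫⁻ _ in Ioo (z - L) z, h z := setLIntegral_mono' measurableSet_Ioo key
    _ = h z * ENNReal.ofReal L := by rw [setLIntegral_const, Real.volume_Ioo]; congr 2; ring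

/-- A log-concave probability density on the line, given together with the moment conditions
under which the central limit theorem applies. -/
structure IsCLTDensity (p : ℝ → ℝ≥0∞) : Prop where
  measurable : Measurable p
  lintegral_eq_one : ∫⁻ x, p x = 1
  exchange : ExchangeLogConcave p
  memLp : MemLp id 2 (volume.withDensity p)
  mean : ∫ x, x ∂(volume.withDensity p) = 0
  variance_ne_zero : Var[id; volume.withDensity p] ≠ 0

lemma IsCLTDensity.isProbabilityMeasure {p : ℝ → ℝ≥0∞} (hp : IsCLTDensity p) :
    IsProbabilityMeasure (volume.withDensity p) :=
  ⟨by simp [hp.lintegral_eq_one]⟩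

lemma IsCLTDensity.exists_mass {p : ℝ → ℝ≥0∞} (hp : IsCLTDensity p) {a b : ℝ} (hab : a < b) :
    ∃ c : ℝ, 0 < c ∧ ∀ᶠ k : ℕ in atTop, ENNReal.ofReal c
      ≤ ∫⁻ x in Ioo (a * √(k + 1)) (b * √(k + 1)), convPow p k x := by
  have := hp.isProbabilityMeasure
  obtain ⟨c, hc, h⟩ := exists_le_lintegral_convPow_Ioo hp.measurable hp.memLp hp.mean
    hp.variance_ne_zero hab
  have hfin : c ≠ ∞ := by
    obtain ⟨k, hk⟩ := h.exists
    refine ne_top_of_le_ne_top ENNReal.one_ne_top (hk.trans ?_)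
    rw [← lintegral_convPow hp.measurable hp.lintegral_eq_one k]
    exact setLIntegral_le_lintegral _ _
  exact ⟨c.toReal, ENNReal.toReal_pos hc.ne' hfin, by rwa [ENNReal.ofReal_toReal hfin]⟩

lemma IsCLTDensity.exists_convPow_le {p : ℝ → ℝ≥0∞} (hp : IsCLTDensity p) :
    ∃ C : ℝ, 0 < C ∧ ∀ᶠ k : ℕ in atTop, ∀ x,
      convPow p k x ≤ ENNReal.ofReal (C / √(k + 1)) := by
  obtain ⟨c₁, hc₁, h₁⟩ := hp.exists_mass (show (1 : ℝ) < 2 by norm_num)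
  obtain ⟨c₂, hc₂, h₂⟩ := hp.exists_mass (show (-2 : ℝ) < -1 by norm_num)
  set c := min c₁ c₂
  have hc : 0 < c := lt_min hc₁ hc₂
  refine ⟨1 / c, by positivity, ?_⟩
  filter_upwards [h₁, h₂] with k h₁ h₂ x
  set r := √((k : ℝ) + 1)
  have hr : 0 < r := Real.sqrt_pos.2 (by positivity)
  have hm := measurable_convPow hp.measurable k
  have h1 := lintegral_convPow hp.measurable hp.lintegral_eq_one k
  have hh := hp.exchange.convPow hp.measurable k
  have main : convPow p k x * ENNReal.ofReal c * ENNReal.ofReal r ≤ 1 := by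
    rcases le_total x 0 with hx | hx
    · refine le_trans ?_ (hh.mul_right_tail_le hm h1 x r)
      gcongr
      refine (ENNReal.ofReal_le_ofReal (min_le_left _ _)).trans (h₁.trans ?_)
      exact lintegral_mono_set fun y hy => by have := hy.1; simp only [mem_Ioi]; linarith
    · refine le_trans ?_ (hh.mul_left_tail_le hm h1 x r)
      gcongr
      refine (ENNReal.ofReal_le_ofReal (min_le_right _ _)).trans (h₂.trans ?_)
      exact lintegral_mono_set fun y hy => by have := hy.2; simp only [mem_Iio]; linarith
  rw [mul_assoc, ← ENNReal.ofReal_mul hc.le] at main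
  have hcr : 0 < c * r := by positivity
  rw [show 1 / c / r = (c * r)⁻¹ by field_simp, ENNReal.ofReal_inv_of_pos hcr]
  rwa [ENNReal.le_inv_iff_mul_le]

lemma IsCLTDensity.exists_le_convPow {p : ℝ → ℝ≥0∞} (hp : IsCLTDensity p) {M : ℝ} (hM : 0 < M) :
    ∃ c : ℝ, 0 < c ∧ ∀ᶠ k : ℕ in atTop, ∀ z, |z| ≤ M * √(k + 1) →
      ENNReal.ofReal (c / √(k + 1)) ≤ convPow p k z := by
  obtain ⟨c₁, hc₁, h₁⟩ := hp.exists_mass (show M < M + 1 by linarith)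
  obtain ⟨c₂, hc₂, h₂⟩ := hp.exists_mass (show -(M + 1) < -M by linarith)
  refine ⟨c₂ * c₁ / (2 * M + 1), by positivity, ?_⟩
  filter_upwards [h₁, h₂] with k h₁ h₂ z hz
  set r := √((k : ℝ) + 1)
  have hr : 0 < r := Real.sqrt_pos.2 (by positivity)
  have hm := measurable_convPow hp.measurable k
  have h1 := lintegral_convPow hp.measurable hp.lintegral_eq_one k
  have hh := hp.exchange.convPow hp.measurable k
  obtain ⟨hz1, hz2⟩ := abs_le.1 hz
  have main := hh.mass_mul_mass_le hm h1 z ((2 * M + 1) * r)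
  have hL : 0 < (2 * M + 1) * r := by positivity
  have : ENNReal.ofReal c₂ * ENNReal.ofReal c₁
      ≤ convPow p k z * ENNReal.ofReal ((2 * M + 1) * r) := by
    refine le_trans ?_ main
    gcongr
    · exact h₂.trans (lintegral_mono_set fun y hy => ⟨by linarith [hy.1], by linarith [hy.2]⟩)
    · exact h₁.trans (lintegral_mono_set fun y hy => by
        have := hy.1; simp only [mem_Ioi]; linarith)
  rw [div_div, ENNReal.ofReal_div_of_pos hL, ENNReal.ofReal_mul hc₂.le]
  exact ENNReal.div_le_of_le_mul this

lemma ConvexOn.add_le_add_of_exchange {H : ℝ → ℝ} (hH : ConvexOn ℝ univ H) {a s t : ℝ}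
    (hs : 0 ≤ s) (ht : 0 ≤ t) : H (a + s) + H (a + t) ≤ H a + H (a + s + t) := by
  rcases eq_or_lt_of_le (add_nonneg hs ht) with h | h
  · obtain rfl : s = 0 := by linarith
    obtain rfl : t = 0 := by linarith
    simp
  · have h1 := hH.2 (mem_univ a) (mem_univ (a + s + t)) (div_nonneg ht h.le) (div_nonneg hs h.le)
      (by field_simp; ring)
    have h2 := hH.2 (mem_univ a) (mem_univ (a + s + t)) (div_nonneg hs h.le) (div_nonneg ht h.le)
      (by field_simp)
    simp only [smul_eq_mul] at h1 h2
    rw [show t / (s + t) * a + s / (s + t) * (a + s + t) = a + s by field_simp; ring] at h1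
    rw [show s / (s + t) * a + t / (s + t) * (a + s + t) = a + t by field_simp; ring] at h2
    have : t / (s + t) * H a + s / (s + t) * H (a + s + t)
        + (s / (s + t) * H a + t / (s + t) * H (a + s + t)) = H a + H (a + s + t) := by
      field_simp; ring
    linarith

lemma RWAssumptions.continuous {H : ℝ → ℝ} (hH : RWAssumptions H) : Continuous H :=
  continuousOn_univ.1 (hH.convex.continuousOn isOpen_univ)

/-- The normalized density of a single increment. -/
noncomputable def incrDensity (H : ℝ → ℝ) (x : ℝ) : ℝ :=
  Real.exp (-(H x)) / ∫ y, Real.exp (-(H y))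

lemma RWAssumptions.incrDensity_nonneg {H : ℝ → ℝ} (hH : RWAssumptions H) (x : ℝ) :
    0 ≤ incrDensity H x := div_nonneg (Real.exp_pos _).le hH.norm_pos.le

lemma RWAssumptions.continuous_incrDensity {H : ℝ → ℝ} (hH : RWAssumptions H) :
    Continuous (incrDensity H) := by
  have := hH.continuous
  unfold incrDensity
  fun_prop

lemma RWAssumptions.integrable_mul_incrDensity {H : ℝ → ℝ} {f : ℝ → ℝ}
    (hf : Integrable fun x => f x * Real.exp (-(H x))) :
    Integrable fun x => f x * incrDensity H x := by
  simpa only [incrDensity, mul_div_assoc] using hf.div_const _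

lemma RWAssumptions.integral_mul_incrDensity {H : ℝ → ℝ} (f : ℝ → ℝ) :
    ∫ x, f x * incrDensity H x
      = (∫ x, f x * Real.exp (-(H x))) / ∫ y, Real.exp (-(H y)) := by
  simp only [incrDensity, ← mul_div_assoc, integral_div]

lemma RWAssumptions.exchangeLogConcave {H : ℝ → ℝ} (hH : RWAssumptions H) :
    ExchangeLogConcave fun x => ENNReal.ofReal (incrDensity H x) := by
  intro a s t hs ht
  rw [← ENNReal.ofReal_mul (hH.incrDensity_nonneg _),
    ← ENNReal.ofReal_mul (hH.incrDensity_nonneg _)]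
  refine ENNReal.ofReal_le_ofReal ?_
  simp only [incrDensity, div_mul_div_comm, ← Real.exp_add]
  have := hH.convex.add_le_add_of_exchange (a := a) hs ht
  have := hH.norm_pos
  gcongr ?_ / _
  exact Real.exp_le_exp.2 (by linarith)

lemma integral_withDensity_ofReal_mul {ρ : ℝ → ℝ} (hρ : Measurable ρ) (h0 : ∀ x, 0 ≤ ρ x)
    (f : ℝ → ℝ) : ∫ x, f x ∂(volume.withDensity fun x => ENNReal.ofReal (ρ x))
      = ∫ x, f x * ρ x := by
  rw [integral_withDensity_eq_integral_toReal_smul (by fun_prop) (by simp)]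
  simp [ENNReal.toReal_ofReal, h0, mul_comm]

lemma RWAssumptions.isCLTDensity {H : ℝ → ℝ} (hH : RWAssumptions H) :
    IsCLTDensity fun x => ENNReal.ofReal (incrDensity H x) := by
  have hc := hH.continuous_incrDensity
  have h0 := hH.incrDensity_nonneg
  have hZ := hH.norm_pos
  have hmean : ∫ x, x ∂(volume.withDensity fun x => ENNReal.ofReal (incrDensity H x)) = 0 := by
    rw [integral_withDensity_ofReal_mul hc.measurable h0,
      RWAssumptions.integral_mul_incrDensity, hH.mean_zero, zero_div]
  refine ⟨by fun_prop, ?_, hH.exchangeLogConcave, ?_, hmean, ?_⟩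
  · have hi : Integrable (incrDensity H) := hH.integrable_exp.div_const _
    rw [← ofReal_integral_eq_lintegral_ofReal hi (.of_forall h0)]
    have : ∫ x, incrDensity H x = 1 := by
      simp only [incrDensity, integral_div]
      exact div_self hZ.ne'
    simp [this]
  · rw [memLp_two_iff_integrable_sq (by fun_prop),
      integrable_withDensity_iff (by fun_prop) (by simp)]
    simp only [id, ENNReal.toReal_ofReal (h0 _)]
    exact RWAssumptions.integrable_mul_incrDensity hH.integrable_sq
  · rw [variance_of_integral_eq_zero (X := id) (by fun_prop) hmean]
    simp only [id]
    rw [integral_withDensity_ofReal_mul hc.measurable h0,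
      RWAssumptions.integral_mul_incrDensity]
    exact (div_pos hH.var_pos hZ).ne'

lemma exp_le_one_add_add_sq_mul_exp_abs (y : ℝ) :
    Real.exp y ≤ 1 + y + y ^ 2 * Real.exp |y| := by
  have h := Complex.norm_exp_sub_sum_le_norm_mul_exp (y : ℂ) 2
  have e : Complex.exp y - ∑ m ∈ Finset.range 2, (y : ℂ) ^ m / (m.factorial : ℂ)
      = ((Real.exp y - (1 + y) : ℝ) : ℂ) := by
    simp [Finset.sum_range_succ]
  rw [e, Complex.norm_real, Complex.norm_real, Real.norm_eq_abs, Real.norm_eq_abs, sq_abs] at h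
  linarith [le_abs_self (Real.exp y - (1 + y))]

lemma sq_le_mul_exp_mul_abs {t : ℝ} (ht : 0 < t) (x : ℝ) :
    x ^ 2 ≤ 2 / t ^ 2 * Real.exp (t * |x|) := by
  have h := Real.quadratic_le_exp_of_nonneg (x := t * |x|) (by positivity)
  have : (t * |x|) ^ 2 / 2 ≤ Real.exp (t * |x|) := by
    have : 0 ≤ t * |x| := by positivity
    linarith
  rw [mul_pow, sq_abs] at this
  rw [div_mul_eq_mul_div, le_div_iff₀ (by positivity)]
  linarith

/-- Near zero, the moment generating function of an increment is dominated by a Gaussian one. -/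
lemma RWAssumptions.exists_mgf_le {H : ℝ → ℝ} (hH : RWAssumptions H) :
    ∃ D : ℝ, 0 ≤ D ∧ ∃ t₁ : ℝ, 0 < t₁ ∧ ∀ θ : ℝ, |θ| ≤ t₁ →
      ∫⁻ x, ENNReal.ofReal (Real.exp (θ * x) * incrDensity H x)
        ≤ ENNReal.ofReal (Real.exp (D * θ ^ 2)) := by
  obtain ⟨t₀, ht₀, hmgf⟩ := hH.mgf
  have hρ0 := hH.incrDensity_nonneg
  have hc := hH.continuous_incrDensity
  set t₁ := t₀ / 2 with ht₁
  have ht₁0 : 0 < t₁ := by positivity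
  have hi1 : Integrable (incrDensity H) := hH.integrable_exp.div_const _
  have hmgf' : ∀ t, |t| ≤ t₀ → Integrable fun x => Real.exp (t * x) * incrDensity H x :=
    fun t ht => RWAssumptions.integrable_mul_incrDensity (hmgf t ht)
  have hi2 : Integrable fun x => x ^ 2 * incrDensity H x :=
    RWAssumptions.integrable_mul_incrDensity hH.integrable_sq
  have hix : Integrable fun x => x * incrDensity H x := by
    refine (hi1.add hi2).mono' (by fun_prop) (.of_forall fun x => ?_)
    rw [norm_mul, Real.norm_of_nonneg (hρ0 x), Real.norm_eq_abs]
    have : |x| ≤ 1 + x ^ 2 := by nlinarith [sq_abs x, sq_nonneg (|x| - 1)]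
    calc |x| * incrDensity H x ≤ (1 + x ^ 2) * incrDensity H x := by gcongr; exact hρ0 x
      _ = _ := by simp only [Pi.add_apply]; ring
  have hmean : ∫ x, x * incrDensity H x = 0 := by
    rw [RWAssumptions.integral_mul_incrDensity, hH.mean_zero, zero_div]
  have hone : ∫ x, incrDensity H x = 1 := by
    simp only [incrDensity, integral_div]
    exact div_self hH.norm_pos.ne'
  have hi3 : Integrable fun x => x ^ 2 * Real.exp (t₁ * |x|) * incrDensity H x := by
    have := ((hmgf' t₀ (abs_of_pos ht₀).le).add
      (hmgf' (-t₀) (by rw [abs_neg, abs_of_pos ht₀]))).const_mul (2 / t₁ ^ 2)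
    refine this.mono' (by fun_prop) (.of_forall fun x => ?_)
    rw [Real.norm_of_nonneg (by have := hρ0 x; positivity)]
    calc x ^ 2 * Real.exp (t₁ * |x|) * incrDensity H x
        ≤ 2 / t₁ ^ 2 * Real.exp (t₁ * |x|) * Real.exp (t₁ * |x|) * incrDensity H x := by
          gcongr
          · exact hρ0 x
          · exact sq_le_mul_exp_mul_abs ht₁0 x
      _ = 2 / t₁ ^ 2 * (Real.exp (t₀ * |x|) * incrDensity H x) := by
          rw [mul_assoc (2 / t₁ ^ 2), ← Real.exp_add, mul_assoc, ht₁]; ring_nf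
      _ ≤ _ := by
          simp only [Pi.add_apply, ← add_mul]
          gcongr
          · exact hρ0 x
          · rcases abs_choice x with h | h <;> rw [h]
            · exact le_add_of_nonneg_right (Real.exp_pos _).le
            · rw [show t₀ * -x = -t₀ * x by ring]
              exact le_add_of_nonneg_left (Real.exp_pos _).le
  set D := ∫ x, x ^ 2 * Real.exp (t₁ * |x|) * incrDensity H x with hD
  refine ⟨D, integral_nonneg fun x => by have := hρ0 x; positivity, t₁, ht₁0, fun θ hθ => ?_⟩
  rw [← ofReal_integral_eq_lintegral_ofReal (hmgf' θ (by linarith))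
    (.of_forall fun x => by have := hρ0 x; positivity)]
  refine ENNReal.ofReal_le_ofReal ?_
  have h12 : Integrable fun x => incrDensity H x + θ * (x * incrDensity H x) :=
    hi1.add (hix.const_mul θ)
  have hint : Integrable fun x => incrDensity H x + θ * (x * incrDensity H x)
      + θ ^ 2 * (x ^ 2 * Real.exp (t₁ * |x|) * incrDensity H x) :=
    h12.add (hi3.const_mul (θ ^ 2))
  calc ∫ x, Real.exp (θ * x) * incrDensity H x
      ≤ ∫ x, (incrDensity H x + θ * (x * incrDensity H x)
        + θ ^ 2 * (x ^ 2 * Real.exp (t₁ * |x|) * incrDensity H x)) := by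
        refine integral_mono (hmgf' θ (by linarith)) hint fun x => ?_
        have h1 : Real.exp (θ * x) ≤ 1 + θ * x + (θ * x) ^ 2 * Real.exp (t₁ * |x|) := by
          refine (exp_le_one_add_add_sq_mul_exp_abs _).trans ?_
          gcongr
          rw [abs_mul]
          gcongr
        have := mul_le_mul_of_nonneg_right h1 (hρ0 x)
        calc _ ≤ _ := this
          _ = _ := by ring
    _ = 1 + θ ^ 2 * D := by
        rw [integral_add h12 (hi3.const_mul _),
          integral_add hi1 (hix.const_mul θ), integral_const_mul, integral_const_mul, hmean, hone,
          mul_zero, add_zero]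
    _ ≤ Real.exp (D * θ ^ 2) := by
        have := Real.add_one_le_exp (D * θ ^ 2)
        linarith [mul_comm D (θ ^ 2)]

lemma RWAssumptions.ofReal_bridgeDensity {H : ℝ → ℝ} (hH : RWAssumptions H) (u v : ℝ) (n : ℕ)
    (q : Fin n → ℝ) : ENNReal.ofReal (bridgeDensity H u v n q)
      = ENNReal.ofReal (∫ x, Real.exp (-(H x))) ^ (n + 1) * ∏ j ∈ Finset.range (n + 1),
        ENNReal.ofReal (incrDensity H (pathOf u v n q (j + 1) - pathOf u v n q j)) := by
  have hZ := hH.norm_pos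
  have hpow := Finset.prod_const (s := Finset.range (n + 1))
    (ENNReal.ofReal (∫ x, Real.exp (-(H x))))
  rw [Finset.card_range] at hpow
  rw [bridgeDensity, ENNReal.ofReal_prod_of_nonneg fun j _ => (Real.exp_pos _).le,
    ← hpow, ← Finset.prod_mul_distrib]
  refine Finset.prod_congr rfl fun j _ => ?_
  rw [← ENNReal.ofReal_mul hZ.le, incrDensity, mul_div_cancel₀ _ hZ.ne']

lemma measurable_prod_increments {w : ℕ → ℝ → ℝ≥0∞} (hw : ∀ i, Measurable (w i)) (u v : ℝ)
    (n : ℕ) : Measurable fun q : Fin n → ℝ => ∏ j ∈ Finset.range (n + 1),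
      w j (pathOf u v n q (j + 1) - pathOf u v n q j) :=
  Finset.measurable_fun_prod _ fun j _ =>
    (hw j).comp ((measurable_pathOf u v n (j + 1)).sub (measurable_pathOf u v n j))

lemma RWAssumptions.lintegral_bridgeMeasure {H : ℝ → ℝ} (hH : RWAssumptions H) (u v : ℝ) (n : ℕ)
    {F : (Fin n → ℝ) → ℝ≥0∞} (hF : Measurable F) :
    ∫⁻ q, F q ∂(bridgeMeasure H u v n)
      = ENNReal.ofReal (∫ x, Real.exp (-(H x))) ^ (n + 1) * ∫⁻ q, (∏ j ∈ Finset.range (n + 1),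
        ENNReal.ofReal (incrDensity H (pathOf u v n q (j + 1) - pathOf u v n q j))) * F q := by
  have hρ := hH.isCLTDensity.measurable
  have hm := measurable_prod_increments (fun _ => hρ) u v n
  simp only [bridgeMeasure, hH.ofReal_bridgeDensity]
  rw [lintegral_withDensity_eq_lintegral_mul _ (hm.const_mul _) hF,
    ← lintegral_const_mul _ (by fun_prop)]
  exact lintegral_congr fun q => by simp only [Pi.mul_apply, mul_assoc]

lemma RWAssumptions.bridgeMeasure_univ {H : ℝ → ℝ} (hH : RWAssumptions H) (u v : ℝ) (n : ℕ) :
    bridgeMeasure H u v n univ = ENNReal.ofReal (∫ x, Real.exp (-(H x))) ^ (n + 1)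
      * convPow (fun x => ENNReal.ofReal (incrDensity H x)) n (v - u) := by
  rw [← lintegral_one, hH.lintegral_bridgeMeasure u v n measurable_const, ← incrConv_const,
    ← lintegral_prod_increments n _ (fun _ => hH.isCLTDensity.measurable) u v]
  simp only [mul_one]

lemma filter_range_Ico_eq {i j m : ℕ} (h : j ≤ m) :
    (Finset.range m).filter (fun l => i ≤ l ∧ l < j) = Finset.Ico i j := by
  ext l
  simp only [Finset.mem_filter, Finset.mem_range, Finset.mem_Ico]
  omega

lemma count_Ico_eq {i k m : ℕ} (h : i + k ≤ m) :
    Nat.count (fun l => i ≤ l ∧ l < i + k) m = k := by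
  rw [Nat.count_eq_card_filter_range, filter_range_Ico_eq h, Nat.card_Ico,
    Nat.add_sub_cancel_left]

lemma count_not_Ico_eq {i k m : ℕ} (h : i + k ≤ m) :
    Nat.count (fun l => ¬ (i ≤ l ∧ l < i + k)) m = m - k := by
  have := count_Ico_eq h
  rw [Nat.count_eq_card_filter_range] at this ⊢
  have h2 := Finset.card_filter_add_card_filter_not (s := Finset.range m)
    (fun l => i ≤ l ∧ l < i + k)
  rw [Finset.card_range] at h2
  omega

lemma sum_ite_Ico_sub (p : ℕ → ℝ) {i k m : ℕ} (h : i + k ≤ m) :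
    ∑ l ∈ Finset.range m, (if i ≤ l ∧ l < i + k then p (l + 1) - p l else 0)
      = p (i + k) - p i := by
  rw [← Finset.sum_filter, filter_range_Ico_eq h, Finset.sum_Ico_eq_sum_range,
    Nat.add_sub_cancel_left]
  simpa [add_assoc] using Finset.sum_range_sub (fun l => p (i + l)) k

/-- Exponential moments of the increments of a bridge. -/
lemma RWAssumptions.lintegral_exp_increment_le {H : ℝ → ℝ} (hH : RWAssumptions H) (u v θ : ℝ)
    {n i k : ℕ} (hk : k ≤ n) (hik : i + k ≤ n + 1) {B : ℝ≥0∞}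
    (hB : ∀ x, convPow (fun x => ENNReal.ofReal (incrDensity H x)) (n - k) x ≤ B) :
    ∫⁻ q, ENNReal.ofReal (Real.exp (θ * (pathOf u v n q (i + k) - pathOf u v n q i)))
        ∂(bridgeMeasure H u v n)
      ≤ ENNReal.ofReal (∫ x, Real.exp (-(H x))) ^ (n + 1)
        * ((∫⁻ x, ENNReal.ofReal (Real.exp (θ * x) * incrDensity H x)) ^ k * B) := by
  have hρ := hH.isCLTDensity.measurable
  have hρc := hH.continuous_incrDensity
  have hp := measurable_pathOf u v n
  have hg : Measurable fun x => ENNReal.ofReal (Real.exp (θ * x) * incrDensity H x) := by fun_prop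
  rw [hH.lintegral_bridgeMeasure u v n (by have := hp i; have := hp (i + k); fun_prop)]
  gcongr
  have key : ∀ q : Fin n → ℝ, (∏ j ∈ Finset.range (n + 1),
      ENNReal.ofReal (incrDensity H (pathOf u v n q (j + 1) - pathOf u v n q j)))
      * ENNReal.ofReal (Real.exp (θ * (pathOf u v n q (i + k) - pathOf u v n q i)))
      = ∏ j ∈ Finset.range (n + 1), (if i ≤ j ∧ j < i + k then
          fun x => ENNReal.ofReal (Real.exp (θ * x) * incrDensity H x)
          else fun x => ENNReal.ofReal (incrDensity H x))
        (pathOf u v n q (j + 1) - pathOf u v n q j) := by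
    intro q
    rw [← sum_ite_Ico_sub (pathOf u v n q) hik, Finset.mul_sum, Real.exp_sum,
      ENNReal.ofReal_prod_of_nonneg fun j _ => (Real.exp_pos _).le, ← Finset.prod_mul_distrib]
    refine Finset.prod_congr rfl fun j _ => ?_
    split_ifs
    · exact (mul_comm _ _).trans (ENNReal.ofReal_mul (Real.exp_pos _).le).symm
    · simp
  simp only [key]
  rw [lintegral_prod_increments n (fun j => if i ≤ j ∧ j < i + k then
          fun x => ENNReal.ofReal (Real.exp (θ * x) * incrDensity H x)
          else fun x => ENNReal.ofReal (incrDensity H x)) (fun j => by split_ifs <;> assumption),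
    incrConv_ite hρ hg, count_Ico_eq hik, count_not_Ico_eq hik,
    show n + 1 - k = n - k + 1 by omega]
  exact mixedConv_succ_le hg _ _ hB _

lemma pow_four_le_exp_add_exp {a : ℝ} (ha : 0 < a) (x : ℝ) :
    x ^ 4 ≤ 24 / a ^ 4 * (Real.exp (a * x) + Real.exp (-a * x)) := by
  have h := Real.pow_div_factorial_le_exp |a * x| (abs_nonneg _) 4
  rw [(by decide : Even 4).pow_abs,
    show ((Nat.factorial 4 : ℕ) : ℝ) = 24 by norm_num [Nat.factorial]] at h
  have h2 : Real.exp |a * x| ≤ Real.exp (a * x) + Real.exp (-a * x) := by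
    rcases abs_choice (a * x) with h | h <;> rw [h]
    · exact le_add_of_nonneg_right (Real.exp_pos _).le
    · rw [← neg_mul]; exact le_add_of_nonneg_left (Real.exp_pos _).le
  rw [div_mul_eq_mul_div, le_div_iff₀ (by positivity)]
  rw [mul_pow] at h
  linarith

lemma RWAssumptions.eventually_bridgeMeasure_univ {H : ℝ → ℝ} (hH : RWAssumptions H) {M : ℝ}
    (hM : 0 < M) : ∀ᶠ n : ℕ in atTop, ∀ z, |z| ≤ M * √(n + 1) →
      bridgeMeasure H 0 z n univ ≠ 0 ∧ bridgeMeasure H 0 z n univ ≠ ∞ := by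
  obtain ⟨C, hC, h₁⟩ := hH.isCLTDensity.exists_convPow_le
  obtain ⟨c, hc, h₂⟩ := hH.isCLTDensity.exists_le_convPow hM
  filter_upwards [h₁, h₂] with n h₁ h₂ z hz
  rw [hH.bridgeMeasure_univ, sub_zero]
  have hZ := hH.norm_pos
  constructor
  · refine mul_ne_zero (pow_ne_zero _ (by simpa using hZ)) (ne_of_gt (lt_of_lt_of_le ?_ (h₂ z hz)))
    rw [ENNReal.ofReal_pos]
    positivity
  · exact ENNReal.mul_ne_top (by finiteness) (ne_top_of_le_ne_top ENNReal.ofReal_ne_top (h₁ z))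

/-- Fourth moments of the increments of a bridge grow at most quadratically in time,
uniformly over endpoints in the diffusive window. -/
lemma RWAssumptions.exists_lintegral_pow_four_le {H : ℝ → ℝ} (hH : RWAssumptions H) {M : ℝ}
    (hM : 0 < M) : ∃ C : ℝ, 0 < C ∧ ∀ᶠ n : ℕ in atTop, ∀ z, |z| ≤ M * √(n + 1) →
      ∀ i k : ℕ, 2 * k ≤ n + 1 →
        ∫⁻ q, ENNReal.ofReal ((pathOf 0 z n q (i + k) - pathOf 0 z n q i) ^ 4)
          ∂(bridgeMeasure H 0 z n) ≤ ENNReal.ofReal (C * k ^ 2) * bridgeMeasure H 0 z n univ := by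
  obtain ⟨C, hC, h₁⟩ := hH.isCLTDensity.exists_convPow_le
  obtain ⟨c, hc, h₂⟩ := hH.isCLTDensity.exists_le_convPow hM
  obtain ⟨D, hD, t, ht, hmgf⟩ := hH.exists_mgf_le
  obtain ⟨K, hK⟩ := eventually_atTop.1 h₁
  set R := Real.exp (D * t ^ 2) * (√2 * C / c) with hR
  refine ⟨24 / t ^ 4 * (2 * R), by positivity, ?_⟩
  filter_upwards [h₂, eventually_ge_atTop (2 * K + 1)] with n h₂ hn z hz
  have main : ∀ i k : ℕ, 0 < k → 2 * k ≤ n + 1 → i + k ≤ n + 1 →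
      ∫⁻ q, ENNReal.ofReal ((pathOf 0 z n q (i + k) - pathOf 0 z n q i) ^ 4)
        ∂(bridgeMeasure H 0 z n) ≤ ENNReal.ofReal (24 / t ^ 4 * (2 * R) * k ^ 2)
          * bridgeMeasure H 0 z n univ := by
    intro i k hk0 hk hik
    have hp := measurable_pathOf 0 z n
    have hk' : (0 : ℝ) < k := by exact_mod_cast hk0
    set θ := t / √k with hθ
    have hθ0 : 0 < θ := by positivity
    have hθ2 : k * θ ^ 2 = t ^ 2 := by
      rw [hθ, div_pow, Real.sq_sqrt hk'.le]; field_simp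
    have hθ4 : 24 / θ ^ 4 = 24 / t ^ 4 * k ^ 2 := by
      rw [show θ ^ 4 = (θ ^ 2) ^ 2 by ring, show θ ^ 2 = t ^ 2 / k by rw [← hθ2]; field_simp]
      field_simp
    have hθt : θ ≤ t := div_le_self ht.le (Real.one_le_sqrt.2 (by exact_mod_cast hk0))
    have hexp : ∀ θ' : ℝ, |θ'| = θ →
        ∫⁻ q, ENNReal.ofReal (Real.exp (θ' * (pathOf 0 z n q (i + k) - pathOf 0 z n q i)))
          ∂(bridgeMeasure H 0 z n) ≤ ENNReal.ofReal R * bridgeMeasure H 0 z n univ := by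
      intro θ' hθ'
      refine (hH.lintegral_exp_increment_le 0 z θ' (by omega) hik (hK (n - k) (by omega))).trans ?_
      rw [hH.bridgeMeasure_univ, sub_zero, mul_left_comm (ENNReal.ofReal R)]
      gcongr _ * ?_
      calc _ ≤ ENNReal.ofReal (Real.exp (D * θ' ^ 2)) ^ k
              * ENNReal.ofReal (C / √((n - k : ℕ) + 1)) := by
            gcongr
            exact hmgf θ' (hθ'.le.trans hθt)
        _ ≤ ENNReal.ofReal (R * (c / √(n + 1))) := by
            rw [← ENNReal.ofReal_pow (Real.exp_pos _).le, ← ENNReal.ofReal_mul (by positivity)]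
            refine ENNReal.ofReal_le_ofReal ?_
            rw [← Real.exp_nat_mul, ← sq_abs, hθ', mul_left_comm, hθ2, hR, mul_assoc]
            gcongr
            rw [show √2 * C / c * (c / √(n + 1)) = C * (√2 / √(n + 1)) by field_simp,
              div_eq_mul_inv]
            gcongr
            rw [inv_le_comm₀ (by positivity) (by positivity), inv_div,
              div_le_iff₀ (by positivity), ← Real.sqrt_mul (by positivity)]
            refine Real.sqrt_le_sqrt ?_
            rw [Nat.cast_sub (by omega)]
            have : (2 * k : ℝ) ≤ n + 1 := by exact_mod_cast hk
            linarith
        _ ≤ _ := by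
            rw [ENNReal.ofReal_mul (by positivity)]
            gcongr
            exact h₂ z hz
    calc _ ≤ ∫⁻ q, ENNReal.ofReal (24 / θ ^ 4)
            * (ENNReal.ofReal (Real.exp (θ * (pathOf 0 z n q (i + k) - pathOf 0 z n q i)))
            + ENNReal.ofReal (Real.exp (-θ * (pathOf 0 z n q (i + k) - pathOf 0 z n q i))))
            ∂(bridgeMeasure H 0 z n) := by
          refine lintegral_mono fun q => ?_
          rw [← ENNReal.ofReal_add (by positivity) (by positivity),
            ← ENNReal.ofReal_mul (by positivity)]
          exact ENNReal.ofReal_le_ofReal (pow_four_le_exp_add_exp hθ0 _)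
      _ = ENNReal.ofReal (24 / θ ^ 4) * (_ + _) := by
          have h1 := hp i
          have h2 := hp (i + k)
          rw [lintegral_const_mul _ (by fun_prop), lintegral_add_left (by fun_prop)]
      _ ≤ ENNReal.ofReal (24 / θ ^ 4) * (ENNReal.ofReal R * bridgeMeasure H 0 z n univ
            + ENNReal.ofReal R * bridgeMeasure H 0 z n univ) := by
          gcongr
          · exact hexp θ (abs_of_pos hθ0)
          · exact hexp (-θ) (by rw [abs_neg, abs_of_pos hθ0])
      _ = _ := by
          have hR0 : 0 ≤ R := by positivity
          rw [← add_mul, ← ENNReal.ofReal_add hR0 hR0, ← mul_assoc,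
            ← ENNReal.ofReal_mul (by positivity), hθ4]
          congr 2
          ring
  intro i k hk
  have hsub : min i (n + 1) + (min (i + k) (n + 1) - min i (n + 1)) = min (i + k) (n + 1) := by
    omega
  set k' := min (i + k) (n + 1) - min i (n + 1) with hk'
  have hkk : k' ≤ k := by omega
  have hrw : ∀ q, pathOf 0 z n q (i + k) - pathOf 0 z n q i
      = pathOf 0 z n q (min i (n + 1) + k') - pathOf 0 z n q (min i (n + 1)) := fun q => by
    rw [hsub, pathOf_min, pathOf_min]
  simp only [hrw]
  rcases Nat.eq_zero_or_pos k' with h0 | h0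
  · simp [h0]
  · refine (main _ k' h0 (by omega) (by omega)).trans ?_
    gcongr

/-- A recursively defined upper bound for `|p (a + i) - p a| ^ 4`, `i ≤ 2 ^ L`, involving only
increments of `p` over dyadic blocks. -/
def dyadicBound (p : ℕ → ℝ) : ℕ → ℕ → ℝ
  | 0, a => (p (a + 1) - p a) ^ 4
  | L + 1, a => dyadicBound p L a + 2 * dyadicBound p L (a + 2 ^ L)
      + 135 * (p (a + 2 ^ L) - p a) ^ 4

lemma dyadicBound_nonneg (p : ℕ → ℝ) (L a : ℕ) : 0 ≤ dyadicBound p L a := by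
  induction L generalizing a with
  | zero => rw [dyadicBound]; positivity
  | succ L ih =>
    have := ih a
    have := ih (a + 2 ^ L)
    rw [dyadicBound]
    positivity

lemma add_pow_four_le (x y : ℝ) : (x + y) ^ 4 ≤ 2 * x ^ 4 + 135 * y ^ 4 := by
  nlinarith [sq_nonneg (x ^ 2 - 2 * x * y - 6 * y ^ 2), sq_nonneg (y * (x - 7 * y))]

lemma pow_four_le_dyadicBound (p : ℕ → ℝ) {L i : ℕ} (a : ℕ) (hi : i ≤ 2 ^ L) :
    (p (a + i) - p a) ^ 4 ≤ dyadicBound p L a := by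
  induction L generalizing a i with
  | zero =>
    rw [dyadicBound]
    obtain rfl | rfl : i = 0 ∨ i = 1 := by rw [pow_zero] at hi; omega
    · rw [add_zero, sub_self, zero_pow (by norm_num)]; positivity
    · rfl
  | succ L ih =>
    rw [dyadicBound]
    have h1 := dyadicBound_nonneg p L a
    have h2 := dyadicBound_nonneg p L (a + 2 ^ L)
    have h3 : 0 ≤ (p (a + 2 ^ L) - p a) ^ 4 := by positivity
    rcases le_or_gt i (2 ^ L) with h | h
    · linarith [ih a h]
    · obtain ⟨j, rfl⟩ := Nat.exists_eq_add_of_le h.le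
      have h4 := ih (i := j) (a + 2 ^ L) (by rw [pow_succ] at hi; omega)
      have h5 := add_pow_four_le (p (a + 2 ^ L + j) - p (a + 2 ^ L)) (p (a + 2 ^ L) - p a)
      rw [sub_add_sub_cancel, add_assoc a] at h5
      rw [add_assoc a] at h4
      linarith

lemma measurable_dyadicBound {Ω : Type*} [MeasurableSpace Ω] {p : Ω → ℕ → ℝ}
    (hp : ∀ t, Measurable fun ω => p ω t) (L a : ℕ) :
    Measurable fun ω => dyadicBound (p ω) L a := by
  induction L generalizing a with
  | zero =>
    have := hp a
    have := hp (a + 1)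
    simp only [dyadicBound]
    fun_prop
  | succ L ih =>
    have := ih a
    have := ih (a + 2 ^ L)
    have := hp a
    have := hp (a + 2 ^ L)
    simp only [dyadicBound]
    fun_prop

lemma lintegral_dyadicBound_le {Ω : Type*} [MeasurableSpace Ω] {μ : Measure Ω} {p : Ω → ℕ → ℝ}
    (hp : ∀ t, Measurable fun ω => p ω t) {C : ℝ} (hC : 0 ≤ C) {m : ℝ≥0∞} {L : ℕ}
    (h : ∀ i k : ℕ, k ≤ 2 ^ L →
      ∫⁻ ω, ENNReal.ofReal ((p ω (i + k) - p ω i) ^ 4) ∂μ ≤ ENNReal.ofReal (C * k ^ 2) * m)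
    (a : ℕ) :
    ∫⁻ ω, ENNReal.ofReal (dyadicBound (p ω) L a) ∂μ ≤ ENNReal.ofReal (135 * C * 4 ^ L) * m := by
  induction L generalizing a with
  | zero =>
    simp only [dyadicBound]
    refine (h a 1 le_rfl).trans ?_
    gcongr
    · linarith
    · norm_num
  | succ L ih =>
    have hm := measurable_dyadicBound hp
    have h1 := hp a
    have h2 := hp (a + 2 ^ L)
    have ih' := ih fun i k hk => h i k (hk.trans (Nat.pow_le_pow_right (by norm_num) L.le_succ))
    have e : ∀ ω, ENNReal.ofReal (dyadicBound (p ω) (L + 1) a)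
        = ENNReal.ofReal (dyadicBound (p ω) L a)
          + ENNReal.ofReal 2 * ENNReal.ofReal (dyadicBound (p ω) L (a + 2 ^ L))
          + ENNReal.ofReal 135 * ENNReal.ofReal ((p ω (a + 2 ^ L) - p ω a) ^ 4) := fun ω => by
      have h1 := dyadicBound_nonneg (p ω) L a
      have h2 := dyadicBound_nonneg (p ω) L (a + 2 ^ L)
      rw [dyadicBound, ENNReal.ofReal_add (by positivity) (by positivity),
        ENNReal.ofReal_add h1 (by positivity), ENNReal.ofReal_mul (by norm_num),
        ENNReal.ofReal_mul (by norm_num)]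
    have hLa := hm L a
    have hLb := hm L (a + 2 ^ L)
    simp only [e]
    rw [lintegral_add_left (by fun_prop), lintegral_add_left (by fun_prop),
      lintegral_const_mul _ (by fun_prop), lintegral_const_mul _ (by fun_prop)]
    calc _ ≤ ENNReal.ofReal (135 * C * 4 ^ L) * m
            + ENNReal.ofReal 2 * (ENNReal.ofReal (135 * C * 4 ^ L) * m)
            + ENNReal.ofReal 135 * (ENNReal.ofReal (C * ((2 ^ L : ℕ) : ℝ) ^ 2) * m) := by
          gcongr
          · exact ih' a
          · exact ih' (a + 2 ^ L)
          · exact h a (2 ^ L) (Nat.pow_le_pow_right (by norm_num) L.le_succ)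
      _ = _ := by
          rw [← mul_assoc, ← mul_assoc, ← add_mul, ← add_mul, ← ENNReal.ofReal_mul (by norm_num),
            ← ENNReal.ofReal_mul (by norm_num),
            ← ENNReal.ofReal_add (by positivity) (by positivity),
            ← ENNReal.ofReal_add (by positivity) (by positivity)]
          congr 2
          push_cast
          rw [← pow_mul, mul_comm L 2, pow_mul]
          norm_num
          ring

/-- Control on dyadic blocks yields a modulus of continuity at the block scale. -/
lemma abs_sub_le_of_blocks {p : ℕ → ℝ} {η : ℝ} {l m : ℕ} (hl : 0 < l)
    (h : ∀ b, b * l ≤ m → ∀ i ≤ l, |p (b * l + i) - p (b * l)| ≤ η) {i j : ℕ} (hi : i ≤ m)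
    (hj : j ≤ m) (hij : i ≤ j) (hjl : j ≤ i + l) : |p i - p j| ≤ 3 * η := by
  have hη : 0 ≤ η := (abs_nonneg _).trans (h 0 (by omega) 0 (by omega))
  set b := i / l
  have hd : b * l + i % l = i := Nat.div_add_mod' i l
  have hr := Nat.mod_lt i hl
  have h1 := abs_le.1 (h b (by omega) (i % l) hr.le)
  rw [hd] at h1
  rcases le_total j (b * l + l) with hc | hc
  · have h2 := abs_le.1 (h b (by omega) (j - b * l) (by omega))
    rw [show b * l + (j - b * l) = j by omega] at h2
    rw [abs_le]
    constructor <;> linarith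
  · have h2 := abs_le.1 (h b (by omega) l le_rfl)
    have hb : (b + 1) * l = b * l + l := by ring
    have h3 := h (b + 1) (by omega) (j - (b * l + l)) (by omega)
    rw [hb, show b * l + l + (j - (b * l + l)) = j by omega] at h3
    have h3 := abs_le.1 h3
    rw [abs_le]
    constructor <;> linarith

lemma abs_interpPath_sub_le {p : ℕ → ℝ} {s c B : ℝ} (hs : 0 ≤ s) (h0 : |p ⌊s⌋₊ - c| ≤ B)
    (h1 : |p (⌊s⌋₊ + 1) - c| ≤ B) : |interpPath p s - c| ≤ B := by
  have ha : 0 ≤ s - (⌊s⌋₊ : ℝ) := sub_nonneg.2 (Nat.floor_le hs)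
  have hb : 0 ≤ 1 - (s - (⌊s⌋₊ : ℝ)) := by linarith [Nat.lt_floor_add_one s]
  rw [interpPath]
  set r := s - (⌊s⌋₊ : ℝ)
  rw [abs_le] at *
  constructor <;> nlinarith

lemma abs_interpPath_sub_interpPath_le {p : ℕ → ℝ} {B : ℝ} {l m : ℕ}
    (h : ∀ i j : ℕ, i ≤ m → j ≤ m → i ≤ j → j ≤ i + l → |p i - p j| ≤ B) {s t : ℝ}
    (hs : 0 ≤ s) (ht : 0 ≤ t) (hsm : s + 1 ≤ m) (htm : t + 1 ≤ m) (hst : |s - t| + 2 ≤ l) :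
    |interpPath p s - interpPath p t| ≤ B := by
  have hfl : ∀ {x : ℝ}, 0 ≤ x → x + 1 ≤ m → ∀ i, i = ⌊x⌋₊ ∨ i = ⌊x⌋₊ + 1 →
      i ≤ m ∧ (i : ℝ) ≤ x + 1 ∧ x - 1 ≤ i := by
    intro x hx hxm i hi
    have h1 := Nat.floor_le hx
    have h2 := Nat.lt_floor_add_one x
    have h3 : (⌊x⌋₊ : ℝ) ≤ i ∧ (i : ℝ) ≤ ⌊x⌋₊ + 1 := by rcases hi with rfl | rfl <;> simp
    refine ⟨?_, by linarith, by linarith⟩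
    exact_mod_cast (show (i : ℝ) ≤ m by linarith)
  have key : ∀ i j : ℕ, i = ⌊s⌋₊ ∨ i = ⌊s⌋₊ + 1 → j = ⌊t⌋₊ ∨ j = ⌊t⌋₊ + 1 →
      |p i - p j| ≤ B := by
    intro i j hi hj
    obtain ⟨him, hi1, hi2⟩ := hfl hs hsm i hi
    obtain ⟨hjm, hj1, hj2⟩ := hfl ht htm j hj
    have hst' := abs_le.1 (show |s - t| ≤ l - 2 by linarith)
    rcases le_total i j with hij | hij
    · exact h i j him hjm hij (by exact_mod_cast (show (j : ℝ) ≤ i + l by linarith))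
    · rw [abs_sub_comm]
      exact h j i hjm him hij (by exact_mod_cast (show (i : ℝ) ≤ j + l by linarith))
  have key' : ∀ i, i = ⌊s⌋₊ ∨ i = ⌊s⌋₊ + 1 → |p i - interpPath p t| ≤ B := fun i hi => by
    rw [abs_sub_comm]
    refine abs_interpPath_sub_le ht ?_ ?_ <;> rw [abs_sub_comm]
    · exact key i _ hi (.inl rfl)
    · exact key i _ hi (.inr rfl)
  exact abs_interpPath_sub_le hs (key' _ (.inl rfl)) (key' _ (.inr rfl))

lemma wMod_le {f : ℝ → ℝ} {T δ B : ℝ} (hB : 0 ≤ B)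
    (h : ∀ s ∈ Icc 0 T, ∀ t ∈ Icc 0 T, |s - t| < δ → |f s - f t| ≤ B) : wMod f T δ ≤ B := by
  refine Real.sSup_le ?_ hB
  rintro d ⟨s, t, hs, ht, hst, rfl⟩
  exact h s hs t ht hst

lemma wMod_rescaled_interpPath_le {p : ℕ → ℝ} {a T δ η : ℝ} {l m : ℕ} (ha : 0 < a) (hl : 0 < l)
    (hη : 0 ≤ η) (hTm : T * a ^ 2 + 1 ≤ m) (hδ : δ * a ^ 2 + 2 ≤ l)
    (h : ∀ b, b * l ≤ m → ∀ i ≤ l, |p (b * l + i) - p (b * l)| ≤ η) :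
    wMod (fun t => a⁻¹ * interpPath p (t * a ^ 2)) T δ ≤ a⁻¹ * (3 * η) := by
  refine wMod_le (by positivity) fun s hs t ht hst => ?_
  rw [← mul_sub, abs_mul, abs_of_pos (inv_pos.2 ha)]
  gcongr
  have hsT : s * a ^ 2 ≤ T * a ^ 2 := by gcongr; exact hs.2
  have htT : t * a ^ 2 ≤ T * a ^ 2 := by gcongr; exact ht.2
  have hd : |s * a ^ 2 - t * a ^ 2| ≤ δ * a ^ 2 := by
    rw [← sub_mul, abs_mul, abs_of_pos (by positivity : 0 < a ^ 2)]
    gcongr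
  exact abs_interpPath_sub_interpPath_le
    (fun i j hi hj hij hjl => abs_sub_le_of_blocks hl h hi hj hij hjl)
    (mul_nonneg hs.1 (by positivity)) (mul_nonneg ht.1 (by positivity))
    (by linarith) (by linarith) (by linarith)

/-- If the fourth moments of the increments of a random path grow quadratically up to the scale
`2 ^ L`, then large oscillations of the rescaled path are unlikely. -/
lemma measure_le_wMod_le {Ω : Type*} [MeasurableSpace Ω] {μ : Measure Ω} {p : Ω → ℕ → ℝ}
    (hp : ∀ t, Measurable fun ω => p ω t) {C : ℝ} (hC : 0 ≤ C) {L m : ℕ}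
    (h : ∀ i k : ℕ, k ≤ 2 ^ L →
      ∫⁻ ω, ENNReal.ofReal ((p ω (i + k) - p ω i) ^ 4) ∂μ ≤ ENNReal.ofReal (C * k ^ 2) * μ univ)
    {a T δ ε : ℝ} (ha : 0 < a) (hε : 0 < ε) (hTm : T * a ^ 2 + 1 ≤ m)
    (hδ : δ * a ^ 2 + 2 ≤ (2 : ℝ) ^ L) :
    μ {ω | ε ≤ wMod (fun t => a⁻¹ * interpPath (p ω) (t * a ^ 2)) T δ}
      ≤ ENNReal.ofReal ((m * 2 ^ L + 4 ^ L) * (135 * C) / (ε * a / 6) ^ 4) * μ univ := by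
  set η := ε * a / 6 with hη
  have hη0 : 0 < η := by positivity
  have hη4 : ENNReal.ofReal (η ^ 4) ≠ 0 := by
    rw [Ne, ENNReal.ofReal_eq_zero, not_le]
    positivity
  have hsub : {ω | ε ≤ wMod (fun t => a⁻¹ * interpPath (p ω) (t * a ^ 2)) T δ}
      ⊆ ⋃ b ∈ Finset.range (m / 2 ^ L + 1),
        {ω | ENNReal.ofReal (η ^ 4) ≤ ENNReal.ofReal (dyadicBound (p ω) L (b * 2 ^ L))} := by
    intro ω hω
    by_contra hcon
    simp only [mem_iUnion, not_exists, Finset.mem_range, mem_ofPred_eq, not_le] at hcon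
    have hblock : ∀ b, b * 2 ^ L ≤ m → ∀ i ≤ 2 ^ L,
        |p ω (b * 2 ^ L + i) - p ω (b * 2 ^ L)| ≤ η := by
      intro b hb i hi
      have h1 := hcon b (Nat.lt_succ_of_le ((Nat.le_div_iff_mul_le (by positivity)).2 hb))
      rw [ENNReal.ofReal_lt_ofReal_iff (by positivity)] at h1
      have h2 := (pow_four_le_dyadicBound (p ω) (b * 2 ^ L) hi).trans_lt h1
      rw [← (by decide : Even 4).pow_abs] at h2
      exact (lt_of_pow_lt_pow_left₀ 4 hη0.le h2).le
    have h3 := wMod_rescaled_interpPath_le ha (l := 2 ^ L) (by positivity) hη0.le hTm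
      (by exact_mod_cast hδ) hblock
    have h4 : a⁻¹ * (3 * η) = ε / 2 := by rw [hη]; field_simp; norm_num
    have h5 : ε ≤ wMod (fun t => a⁻¹ * interpPath (p ω) (t * a ^ 2)) T δ := hω
    linarith
  have hmarkov : ∀ b, μ {ω | ENNReal.ofReal (η ^ 4)
      ≤ ENNReal.ofReal (dyadicBound (p ω) L (b * 2 ^ L))}
      ≤ ENNReal.ofReal (135 * C * 4 ^ L / η ^ 4) * μ univ := by
    intro b
    have hm := measurable_dyadicBound hp L (b * 2 ^ L)
    have := (meas_ge_le_lintegral_div (μ := μ) (f := fun ω => ENNReal.ofReal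
      (dyadicBound (p ω) L (b * 2 ^ L))) hm.ennreal_ofReal.aemeasurable hη4 ENNReal.ofReal_ne_top)
    refine this.trans ((ENNReal.div_le_div_right (lintegral_dyadicBound_le hp hC h _) _).trans ?_)
    rw [ENNReal.ofReal_div_of_pos (by positivity), ENNReal.mul_div_right_comm]
  calc _ ≤ ∑ b ∈ Finset.range (m / 2 ^ L + 1), μ {ω | ENNReal.ofReal (η ^ 4)
          ≤ ENNReal.ofReal (dyadicBound (p ω) L (b * 2 ^ L))} :=
        (measure_mono hsub).trans (measure_biUnion_finset_le _ _)
    _ ≤ ∑ b ∈ Finset.range (m / 2 ^ L + 1), ENNReal.ofReal (135 * C * 4 ^ L / η ^ 4) * μ univ :=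
        Finset.sum_le_sum fun b _ => hmarkov b
    _ = ENNReal.ofReal (((m / 2 ^ L + 1 : ℕ) : ℝ) * (135 * C * 4 ^ L / η ^ 4)) * μ univ := by
        rw [Finset.sum_const, Finset.card_range, nsmul_eq_mul,
          ENNReal.ofReal_mul (Nat.cast_nonneg _), ENNReal.ofReal_natCast, ← mul_assoc]
    _ ≤ _ := by
        gcongr
        have hdiv : ((m / 2 ^ L : ℕ) : ℝ) ≤ m / 2 ^ L := by
          simpa using Nat.cast_div_le (α := ℝ) (m := m) (n := 2 ^ L)
        calc _ ≤ (m / 2 ^ L + 1 : ℝ) * (135 * C * 4 ^ L / η ^ 4) := by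
              push_cast
              gcongr
          _ = _ := by
              rw [show (4 : ℝ) ^ L = 2 ^ L * 2 ^ L by rw [← mul_pow]; norm_num]
              field_simp

/-- Modulus of continuity bound uniform in endpoint: for any `ν, ε, T, M > 0`
there exist `N₀` and `δ > 0` such that for all `N ≥ N₀` and all `|z| ≤ M N^{1/3}`,
the diffusively rescaled random walk bridge
`y^N(t) = N^{-1/3} X(t N^{2/3})` from `0` to `z` on `⟦0, ⌈T N^{2/3}⌉⟧`
(linearly interpolated) satisfies `P(w(y^N, δ) ≥ ε) < ν`. -/
theorem uniform_modulus_of_continuity (H : ℝ → ℝ) (hH : RWAssumptions H)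
    (ν ε T M : ℝ) (hν : 0 < ν) (hε : 0 < ε) (hT : 0 < T) (hM : 0 < M) :
    ∃ N₀ : ℕ, ∃ δ > 0, ∀ N : ℕ, N₀ ≤ N → ∀ z : ℝ,
      |z| ≤ M * (N : ℝ) ^ ((1 : ℝ) / 3) →
      probOf (bridgeMeasure H 0 z (⌈T * (N : ℝ) ^ ((2 : ℝ) / 3)⌉₊ - 1))
          {q | ε ≤ wMod (fun t => (N : ℝ) ^ (-(1 : ℝ) / 3) *
              interpPath
                (pathOf 0 z (⌈T * (N : ℝ) ^ ((2 : ℝ) / 3)⌉₊ - 1) q)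
                (t * (N : ℝ) ^ ((2 : ℝ) / 3))) T δ}
        < ENNReal.ofReal ν := by
  obtain ⟨C, hC, hmom⟩ := hH.exists_lintegral_pow_four_le (div_pos hM (Real.sqrt_pos.2 hT))
  set c := 135 * C * 24 * 6 ^ 4 * T / ε ^ 4 with hc
  have hc0 : 0 < c := by positivity
  set δ := min (T / 8) (ν / (2 * c)) with hδ
  have hδ0 : 0 < δ := by positivity
  have hδT : δ ≤ T / 8 := min_le_left _ _
  have hδc : c * δ < ν := by
    have : c * δ ≤ c * (ν / (2 * c)) := by gcongr; exact min_le_right _ _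
    have e : c * (ν / (2 * c)) = ν / 2 := by field_simp
    linarith
  have hA : Tendsto (fun N : ℕ => (N : ℝ) ^ ((2 : ℝ) / 3)) atTop atTop :=
    (tendsto_rpow_atTop (by norm_num)).comp tendsto_natCast_atTop_atTop
  have hn : Tendsto (fun N : ℕ => ⌈T * (N : ℝ) ^ ((2 : ℝ) / 3)⌉₊ - 1) atTop atTop :=
    (tendsto_sub_atTop_nat 1).comp (tendsto_nat_ceil_atTop.comp (hA.const_mul_atTop hT))
  obtain ⟨N₀, hN₀⟩ := eventually_atTop.1 (((hn.eventually hmom).and (hn.eventually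
    (hH.eventually_bridgeMeasure_univ (div_pos hM (Real.sqrt_pos.2 hT))))).and
    ((hA.eventually_ge_atTop (2 / δ)).and (eventually_gt_atTop 0)))
  refine ⟨N₀, δ, hδ0, fun N hN z hz => ?_⟩
  obtain ⟨⟨hmomN, hμN⟩, hAN, hN0⟩ := hN₀ N hN
  have hN0' : (0 : ℝ) < N := by exact_mod_cast hN0
  set a := (N : ℝ) ^ ((1 : ℝ) / 3) with ha
  have ha0 : 0 < a := by positivity
  have ha2 : (N : ℝ) ^ ((2 : ℝ) / 3) = a ^ 2 := by
    rw [ha, ← Real.rpow_natCast, ← Real.rpow_mul hN0'.le]; norm_num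
  have hainv : (N : ℝ) ^ (-(1 : ℝ) / 3) = a⁻¹ := by
    rw [ha, ← Real.rpow_neg hN0'.le]; norm_num
  rw [ha2] at hmomN hμN hAN ⊢
  rw [hainv]
  have hδa : 2 ≤ δ * a ^ 2 := by rwa [div_le_iff₀' hδ0] at hAN
  have hTa : 8 * (δ * a ^ 2) ≤ T * a ^ 2 := by
    rw [← mul_assoc]; gcongr; linarith
  have hceil := Nat.le_ceil (T * a ^ 2)
  have hceil' := Nat.ceil_lt_add_one (a := T * a ^ 2) (by positivity)
  set n := ⌈T * a ^ 2⌉₊ - 1 with hn_def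
  have hpos : 0 < ⌈T * a ^ 2⌉₊ := Nat.ceil_pos.2 (by positivity)
  have hn1 : ⌈T * a ^ 2⌉₊ = n + 1 := by omega
  rw [hn1] at hceil hceil'
  push_cast at hceil hceil'
  have hz' : |z| ≤ M / √T * √(n + 1) := by
    refine hz.trans ?_
    calc M * a = M / √T * √(T * a ^ 2) := by
          rw [Real.sqrt_mul hT.le, Real.sqrt_sq ha0.le]
          have := Real.sqrt_pos.2 hT
          field_simp
      _ ≤ _ := by gcongr
  obtain ⟨L, hL1, hL2⟩ := exists_nat_pow_near (show 1 ≤ δ * a ^ 2 + 2 by linarith)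
    (one_lt_two : (1 : ℝ) < 2)
  have hL3 : (2 : ℝ) ^ (L + 1) ≤ 4 * (δ * a ^ 2) := by rw [pow_succ]; linarith
  obtain ⟨hμ0, hμtop⟩ := hμN z hz'
  have hbound := measure_le_wMod_le (μ := bridgeMeasure H 0 z n) (measurable_pathOf 0 z n) hC.le
    (L := L + 1) (m := n + 2) (T := T) (δ := δ) (fun i k hk => hmomN z hz' i k (by
      have h1 : (k : ℝ) ≤ 2 ^ (L + 1) := by exact_mod_cast hk
      exact_mod_cast (show (2 * k : ℝ) ≤ n + 1 by linarith)))
    ha0 hε (by push_cast; linarith) hL2.le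
  rw [probOf]
  refine (ENNReal.div_le_of_le_mul hbound).trans_lt ((ENNReal.ofReal_lt_ofReal_iff hν).2 ?_)
  refine lt_of_le_of_lt ?_ hδc
  have h4 : (4 : ℝ) ^ (L + 1) = 2 ^ (L + 1) * 2 ^ (L + 1) := by rw [← mul_pow]; norm_num
  calc (((n + 2 : ℕ) : ℝ) * 2 ^ (L + 1) + 4 ^ (L + 1)) * (135 * C) / (ε * a / 6) ^ 4
      ≤ (2 * (T * a ^ 2) * (4 * (δ * a ^ 2)) + 4 * (T * a ^ 2) * (4 * (δ * a ^ 2))) * (135 * C)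
          / (ε * a / 6) ^ 4 := by
        rw [h4]
        gcongr
        · push_cast; linarith
        · linarith
    _ = c * δ := by
        rw [hc]
        field_simp
        norm_num
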